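/- With the notation of the extreme Myers–Perry conformal data and assuming additionally a ≠ b, there is a constant C > 0 (depending only on a and b) such that for all r > 0 and θ ∈ (0, π/2): |R̃₀(r,θ)| ≤ C·r^{-4}, where R̃₀ = r²·( −2Δ₂U + ( ⟨dσ'₁₁, dσ'₂₂⟩ − ⟨dσ'₁₂, dσ'₁₂⟩ )/(2ρ²) ), U = ½ log( Σ/(r⁴Φ₀²) ), and Δ₂ f = r^{-4}( r² ∂²_r f + r ∂_r f + ∂²_θ f ) is the flat two-dimensional Laplacian in (r,θ)-coordinates. -/

import Mathlib

noncomputable section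

namespace MP

/-- `Σ = r² + ab + a²cos²θ + b²sin²θ`. -/
def Sig (a b r θ : ℝ) : ℝ :=
  r ^ 2 + a * b + a ^ 2 * Real.cos θ ^ 2 + b ^ 2 * Real.sin θ ^ 2

/-- `A = r² + ab + a²`. -/
def Afun (a b r : ℝ) : ℝ := r ^ 2 + a * b + a ^ 2

/-- `B = r² + ab + b²`. -/
def Bfun (a b r : ℝ) : ℝ := r ^ 2 + a * b + b ^ 2

/-- `σ₁₁ = a²μ sin⁴θ/Σ + A sin²θ`, with `μ = (a+b)²`. -/
def sig11 (a b r θ : ℝ) : ℝ :=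
  a ^ 2 * (a + b) ^ 2 * Real.sin θ ^ 4 / Sig a b r θ + Afun a b r * Real.sin θ ^ 2

/-- `σ₂₂ = b²μ cos⁴θ/Σ + B cos²θ`, with `μ = (a+b)²`. -/
def sig22 (a b r θ : ℝ) : ℝ :=
  b ^ 2 * (a + b) ^ 2 * Real.cos θ ^ 4 / Sig a b r θ + Bfun a b r * Real.cos θ ^ 2

/-- `σ₁₂ = abμ sin²θ cos²θ/Σ`, with `μ = (a+b)²`. -/
def sig12 (a b r θ : ℝ) : ℝ :=
  a * b * (a + b) ^ 2 * Real.sin θ ^ 2 * Real.cos θ ^ 2 / Sig a b r θ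

/-- `ρ = r² sinθ cosθ (= ½ r² sin 2θ)`. -/
def rho (r θ : ℝ) : ℝ := r ^ 2 * Real.sin θ * Real.cos θ

/-- `det σ = σ₁₁σ₂₂ − σ₁₂²`. -/
def detSig (a b r θ : ℝ) : ℝ :=
  sig11 a b r θ * sig22 a b r θ - sig12 a b r θ ^ 2

/-- The conformal factor `Φ₀ > 0`, defined by `Φ₀² = √(det σ)/ρ`. -/
def Phi0 (a b r θ : ℝ) : ℝ := Real.sqrt (Real.sqrt (detSig a b r θ) / rho r θ)

end MP


namespace MP

/-- Partial derivative in the first (radial) variable. -/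
def pdr (f : ℝ → ℝ → ℝ) (r θ : ℝ) : ℝ := deriv (fun s => f s θ) r

/-- Partial derivative in the second (angular) variable. -/
def pdt (f : ℝ → ℝ → ℝ) (r θ : ℝ) : ℝ := deriv (fun t => f r t) θ

/-- The flat four-dimensional Laplacian on biaxisymmetric functions:
`Δ₄ f = ∂²_r f + (3/r)∂_r f + r⁻²(∂²_θ f + (cot θ − tan θ)∂_θ f)`. -/
def Delta4 (f : ℝ → ℝ → ℝ) (r θ : ℝ) : ℝ :=
  pdr (pdr f) r θ + (3 / r) * pdr f r θ +
    (pdt (pdt f) r θ +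
        (Real.cos θ / Real.sin θ - Real.sin θ / Real.cos θ) * pdt f r θ) / r ^ 2

/-- Inner product of differentials in the flat two-metric `dρ² + dz²`
expressed in `(r,θ)`-coordinates:
`⟨df, dg⟩ = r⁻²(∂_r f ∂_r g + r⁻² ∂_θ f ∂_θ g)`. -/
def dInner (f g : ℝ → ℝ → ℝ) (r θ : ℝ) : ℝ :=
  (pdr f r θ * pdr g r θ + pdt f r θ * pdt g r θ / r ^ 2) / r ^ 2

/-- The flat two-dimensional Laplacian in `(r,θ)`-coordinates:
`Δ₂ f = r⁻⁴(r² ∂²_r f + r ∂_r f + ∂²_θ f)`. -/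
def Delta2 (f : ℝ → ℝ → ℝ) (r θ : ℝ) : ℝ :=
  (r ^ 2 * pdr (pdr f) r θ + r * pdr f r θ + pdt (pdt f) r θ) / r ^ 4

end MP


namespace MP

/-- `σ'₁₁ = σ₁₁/Φ₀²`. -/
def sig11' (a b : ℝ) (r θ : ℝ) : ℝ := sig11 a b r θ / Phi0 a b r θ ^ 2

/-- `σ'₂₂ = σ₂₂/Φ₀²`. -/
def sig22' (a b : ℝ) (r θ : ℝ) : ℝ := sig22 a b r θ / Phi0 a b r θ ^ 2

/-- `σ'₁₂ = σ₁₂/Φ₀²`. -/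
def sig12' (a b : ℝ) (r θ : ℝ) : ℝ := sig12 a b r θ / Phi0 a b r θ ^ 2

/-- Twist potential `ω_φ`. -/
def omegaPhi (a b : ℝ) (r θ : ℝ) : ℝ :=
  (a * (a ^ 2 - b ^ 2) * Bfun a b r * Real.cos θ ^ 2 -
      a * r ^ 2 * (2 * a ^ 2 + 2 * a * b + r ^ 2)) / (a - b) ^ 2 +
    a * Afun a b r ^ 2 * Bfun a b r / (Sig a b r θ * (a - b) ^ 2)

/-- Twist potential `ω_ψ`. -/
def omegaPsi (a b : ℝ) (r θ : ℝ) : ℝ :=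
  (b * r ^ 2 * ((a + b) ^ 2 + r ^ 2) -
      b * (a ^ 2 - b ^ 2) * Afun a b r * Real.cos θ ^ 2) / (a - b) ^ 2 -
    b * Afun a b r * Bfun a b r ^ 2 / (Sig a b r θ * (a - b) ^ 2)

/-- The squared conformal extrinsic curvature
`K̃₀² = (r²/(2ρ⁴))(σ'₁₁⟨dω_ψ,dω_ψ⟩ + σ'₂₂⟨dω_φ,dω_φ⟩ − 2σ'₁₂⟨dω_φ,dω_ψ⟩)`. -/
def Ksq (a b : ℝ) (r θ : ℝ) : ℝ :=
  r ^ 2 / (2 * rho r θ ^ 4) *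
    (sig11' a b r θ * dInner (omegaPsi a b) (omegaPsi a b) r θ +
      sig22' a b r θ * dInner (omegaPhi a b) (omegaPhi a b) r θ -
      2 * sig12' a b r θ * dInner (omegaPhi a b) (omegaPsi a b) r θ)

/-- `U = ½ log(Σ/(r⁴Φ₀²))`. -/
def Ufun (a b : ℝ) (r θ : ℝ) : ℝ :=
  Real.log (Sig a b r θ / (r ^ 4 * Phi0 a b r θ ^ 2)) / 2

/-- The rescaled scalar curvature of the conformal slice metric:
`R̃₀ = r²(−2Δ₂U + (⟨dσ'₁₁,dσ'₂₂⟩ − ⟨dσ'₁₂,dσ'₁₂⟩)/(2ρ²))`. -/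
def Rt0 (a b : ℝ) (r θ : ℝ) : ℝ :=
  r ^ 2 * (-2 * Delta2 (Ufun a b) r θ +
    (dInner (sig11' a b) (sig22' a b) r θ -
        dInner (sig12' a b) (sig12' a b) r θ) / (2 * rho r θ ^ 2))

end MP


namespace MPaux

/-! ### A small calculus of orders of growth in `x`, uniform in `s, c ∈ [0,1]`. -/

/-- `|f| ≤ C (1+x)^k` uniformly for `x ≥ 0`, `s, c ∈ [0,1]`. -/
def OB (k : ℤ) (f : ℝ → ℝ → ℝ → ℝ) : Prop :=
  ∃ C : ℝ, 0 ≤ C ∧ ∀ x s c : ℝ, 0 < x → 0 ≤ s → s ≤ 1 → 0 ≤ c → c ≤ 1 →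
    |f x s c| ≤ C * (1 + x) ^ k

theorem OB.le {i k : ℤ} {f : ℝ → ℝ → ℝ → ℝ} (h : OB i f) (hik : i ≤ k) : OB k f := by
  obtain ⟨C, hC, h⟩ := h
  refine ⟨C, hC, fun x s c hx h1 h2 h3 h4 => (h x s c hx h1 h2 h3 h4).trans ?_⟩
  exact mul_le_mul_of_nonneg_left (zpow_le_zpow_right₀ (by linarith) hik) hC

theorem OB.mul {i j : ℤ} {f g : ℝ → ℝ → ℝ → ℝ} (hf : OB i f) (hg : OB j g) :
    OB (i + j) (fun x s c => f x s c * g x s c) := by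
  obtain ⟨C, hC, hf⟩ := hf
  obtain ⟨D, hD, hg⟩ := hg
  refine ⟨C * D, mul_nonneg hC hD, fun x s c hx h1 h2 h3 h4 => ?_⟩
  have hX : (0 : ℝ) < 1 + x := by linarith
  rw [abs_mul, zpow_add₀ hX.ne']
  calc |f x s c| * |g x s c| ≤ (C * (1 + x) ^ i) * (D * (1 + x) ^ j) :=
        mul_le_mul (hf x s c hx h1 h2 h3 h4) (hg x s c hx h1 h2 h3 h4) (abs_nonneg _)
          (mul_nonneg hC (zpow_pos hX _).le)
    _ = _ := by ring

theorem OB.add {k : ℤ} {f g : ℝ → ℝ → ℝ → ℝ} (hf : OB k f) (hg : OB k g) :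
    OB k (fun x s c => f x s c + g x s c) := by
  obtain ⟨C, hC, hf⟩ := hf
  obtain ⟨D, hD, hg⟩ := hg
  refine ⟨C + D, add_nonneg hC hD, fun x s c hx h1 h2 h3 h4 => ?_⟩
  have := abs_add_le (f x s c) (g x s c)
  have := hf x s c hx h1 h2 h3 h4
  have := hg x s c hx h1 h2 h3 h4
  linarith

theorem OB.neg {k : ℤ} {f : ℝ → ℝ → ℝ → ℝ} (hf : OB k f) :
    OB k (fun x s c => - f x s c) := by
  obtain ⟨C, hC, hf⟩ := hf
  refine ⟨C, hC, fun x s c hx h1 h2 h3 h4 => ?_⟩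
  rw [abs_neg]
  exact hf x s c hx h1 h2 h3 h4

theorem OB.sub {k : ℤ} {f g : ℝ → ℝ → ℝ → ℝ} (hf : OB k f) (hg : OB k g) :
    OB k (fun x s c => f x s c - g x s c) := by
  simpa only [sub_eq_add_neg] using hf.add hg.neg

theorem OB.const (t : ℝ) : OB 0 (fun _ _ _ => t) :=
  ⟨|t|, abs_nonneg _, fun x s c _ _ _ _ _ => by simp⟩

theorem OB.cmul {k : ℤ} {f : ℝ → ℝ → ℝ → ℝ} (t : ℝ) (hf : OB k f) :
    OB k (fun x s c => t * f x s c) := by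
  simpa using (OB.const t).mul hf

theorem OB.X : OB 1 (fun x _ _ => x) :=
  ⟨1, zero_le_one, fun x s c hx _ _ _ _ => by rw [abs_of_pos hx]; simp⟩

theorem OB.S : OB 0 (fun _ s _ => s) :=
  ⟨1, zero_le_one, fun x s c hx h1 h2 _ _ => by rw [abs_of_nonneg h1]; simpa⟩

theorem OB.C : OB 0 (fun _ _ c => c) :=
  ⟨1, zero_le_one, fun x s c hx _ _ h1 h2 => by rw [abs_of_nonneg h1]; simpa⟩

theorem OB.congr {k : ℤ} {f g : ℝ → ℝ → ℝ → ℝ} (hf : OB k f)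
    (h : ∀ x s c : ℝ, 0 < x → 0 ≤ s → 0 ≤ c → g x s c = f x s c) : OB k g := by
  obtain ⟨C, hC, hf⟩ := hf
  exact ⟨C, hC, fun x s c hx h1 h2 h3 h4 => by
    rw [h x s c hx h1 h3]; exact hf x s c hx h1 h2 h3 h4⟩

/-! ### The basic polynomials -/

def s0 (a b s c : ℝ) : ℝ := a * b + a ^ 2 * c + b ^ 2 * s
def AA (a b x : ℝ) : ℝ := x + (a * b + a ^ 2)
def BB (a b x : ℝ) : ℝ := x + (a * b + b ^ 2)
def SS (a b x s c : ℝ) : ℝ := x + s0 a b s c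
def PP (a b x s c : ℝ) : ℝ := AA a b x * BB a b x * SS a b x s c +
  (a + b) ^ 2 * (a ^ 2 * (BB a b x * s) + b ^ 2 * (AA a b x * c))
def PPx (a b x s c : ℝ) : ℝ := (AA a b x + BB a b x) * SS a b x s c + AA a b x * BB a b x +
  (a + b) ^ 2 * (a ^ 2 * s + b ^ 2 * c)
def PPxx (a b x s c : ℝ) : ℝ := 2 * SS a b x s c + 2 * (AA a b x + BB a b x)
def PPs (a b x : ℝ) : ℝ := (b ^ 2 - a ^ 2) * (AA a b x * BB a b x) +
  (a + b) ^ 2 * (a ^ 2 * BB a b x - b ^ 2 * AA a b x)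
/-- `p = x P_x - 3 P`. -/
def pd (a b x s c : ℝ) : ℝ :=
  (a + b) ^ 2 * (x * (a ^ 2 * s + b ^ 2 * c)
      - 3 * (a ^ 2 * (BB a b x * s) + b ^ 2 * (AA a b x * c)))
    - (a * b + a ^ 2) * (BB a b x * SS a b x s c) - (a * b + b ^ 2) * (AA a b x * SS a b x s c)
    - s0 a b s c * (AA a b x * BB a b x)
def pdx (a b x s c : ℝ) : ℝ :=
  (-2 * (a + b) ^ 2) * (a ^ 2 * s + b ^ 2 * c)
    - (a * b + a ^ 2) * (BB a b x + SS a b x s c) - (a * b + b ^ 2) * (AA a b x + SS a b x s c)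
    - s0 a b s c * (AA a b x + BB a b x)

theorem pd_eq (a b x s c : ℝ) : x * PPx a b x s c = 3 * PP a b x s c + pd a b x s c := by
  simp only [PPx, PP, pd, SS, s0, AA, BB]; ring

theorem pdx_eq (a b x s c : ℝ) :
    x ^ 2 * PPxx a b x s c = 6 * PP a b x s c + 2 * pd a b x s c + x * pdx a b x s c := by
  simp only [PPxx, PP, pd, pdx, SS, s0, AA, BB]; ring

theorem OB_s0 (a b : ℝ) : OB 0 (fun _ s c => s0 a b s c) :=
  ((OB.const _).add (OB.C.cmul _)).add (OB.S.cmul _)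

theorem OB_AA (a b : ℝ) : OB 1 (fun x _ _ => AA a b x) :=
  OB.X.add ((OB.const _).le (by norm_num))

theorem OB_BB (a b : ℝ) : OB 1 (fun x _ _ => BB a b x) :=
  OB.X.add ((OB.const _).le (by norm_num))

theorem OB_SS (a b : ℝ) : OB 1 (fun x s c => SS a b x s c) :=
  OB.X.add ((OB_s0 a b).le (by norm_num))

theorem OB_PPs (a b : ℝ) : OB 2 (fun x _ _ => PPs a b x) :=
  (((OB_AA a b).mul (OB_BB a b)).cmul _).add
    (((((OB_BB a b).cmul _).sub ((OB_AA a b).cmul _)).cmul _).le (by norm_num))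

theorem OB_w (a b : ℝ) : OB 0 (fun _ s c => a ^ 2 * s + b ^ 2 * c) :=
  (OB.S.cmul _).add (OB.C.cmul _)

theorem OB_lin (a b : ℝ) :
    OB 1 (fun x s c => a ^ 2 * (BB a b x * s) + b ^ 2 * (AA a b x * c)) :=
  (((OB_BB a b).mul OB.S).cmul _).add (((OB_AA a b).mul OB.C).cmul _)

theorem OB_pd (a b : ℝ) : OB 2 (fun x s c => pd a b x s c) :=
  ((((((OB.X.mul (OB_w a b)).sub ((OB_lin a b).cmul 3)).cmul _).le (by norm_num)).sub
    (((OB_BB a b).mul (OB_SS a b)).cmul _)).sub (((OB_AA a b).mul (OB_SS a b)).cmul _)).sub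
    ((OB_s0 a b).mul ((OB_AA a b).mul (OB_BB a b)))

theorem OB_pdx (a b : ℝ) : OB 1 (fun x s c => pdx a b x s c) :=
  (((((OB_w a b).cmul _).le (by norm_num)).sub
    (((OB_BB a b).add (OB_SS a b)).cmul _)).sub (((OB_AA a b).add (OB_SS a b)).cmul _)).sub
    ((OB_s0 a b).mul ((OB_AA a b).add (OB_BB a b)))


theorem s0_ge {a b s c : ℝ} (hs : 0 ≤ s) (hc : 0 ≤ c) : a * b ≤ s0 a b s c := by
  unfold s0; nlinarith [mul_nonneg (sq_nonneg a) hc, mul_nonneg (sq_nonneg b) hs]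

theorem SS_pos {a b x s c : ℝ} (ha : 0 < a) (hb : 0 < b) (hx : 0 < x) (hs : 0 ≤ s)
    (hc : 0 ≤ c) : 0 < SS a b x s c := by
  have := s0_ge (a := a) (b := b) hs hc
  have := mul_pos ha hb
  unfold SS; linarith

theorem low {a b x y : ℝ} (hx : 0 < x) (hy : x + a * b ≤ y) :
    min 1 (a * b) * (1 + x) ≤ y := by
  have h1 := min_le_left 1 (a * b)
  have h2 := min_le_right 1 (a * b)
  nlinarith

theorem PP_ge {a b x s c : ℝ} (ha : 0 < a) (hb : 0 < b) (hx : 0 < x) (hs : 0 ≤ s)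
    (hc : 0 ≤ c) : (min 1 (a * b) * (1 + x)) ^ 3 ≤ PP a b x s c := by
  have hm : 0 < min 1 (a * b) := lt_min one_pos (mul_pos ha hb)
  have hX : 0 < min 1 (a * b) * (1 + x) := mul_pos hm (by linarith)
  have hA := low (a := a) (b := b) (y := AA a b x) hx (by unfold AA; nlinarith [sq_nonneg a])
  have hB := low (a := a) (b := b) (y := BB a b x) hx (by unfold BB; nlinarith [sq_nonneg b])
  have hS := low (a := a) (b := b) (y := SS a b x s c) hx (by
    have := s0_ge (a := a) (b := b) hs hc
    unfold SS; linarith)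
  have hA0 := hX.trans_le hA
  have hB0 := hX.trans_le hB
  have : (min 1 (a * b) * (1 + x)) ^ 3 ≤ AA a b x * BB a b x * SS a b x s c := by
    rw [pow_succ, sq]; gcongr
  unfold PP
  have : 0 ≤ (a + b) ^ 2 * (a ^ 2 * (BB a b x * s) + b ^ 2 * (AA a b x * c)) := by positivity
  linarith

theorem PP_pos {a b x s c : ℝ} (ha : 0 < a) (hb : 0 < b) (hx : 0 < x) (hs : 0 ≤ s)
    (hc : 0 ≤ c) : 0 < PP a b x s c := by
  refine lt_of_lt_of_le ?_ (PP_ge ha hb hx hs hc)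
  have hm : 0 < min 1 (a * b) := lt_min one_pos (mul_pos ha hb)
  positivity

theorem OB_SSinv {a b : ℝ} (ha : 0 < a) (hb : 0 < b) :
    OB (-1) (fun x s c => (SS a b x s c)⁻¹) := by
  have hm : 0 < min 1 (a * b) := lt_min one_pos (mul_pos ha hb)
  refine ⟨(min 1 (a * b))⁻¹, by positivity, fun x s c hx h1 _ h2 _ => ?_⟩
  rw [abs_of_pos (inv_pos.2 (SS_pos ha hb hx h1 h2)), zpow_neg_one, ← mul_inv]
  have hX : 0 < min 1 (a * b) * (1 + x) := mul_pos hm (by linarith)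
  refine inv_anti₀ hX (low hx ?_)
  have := s0_ge (a := a) (b := b) h1 h2
  unfold SS; linarith

theorem OB_PPinv {a b : ℝ} (ha : 0 < a) (hb : 0 < b) :
    OB (-3) (fun x s c => (PP a b x s c)⁻¹) := by
  have hm : 0 < min 1 (a * b) := lt_min one_pos (mul_pos ha hb)
  refine ⟨((min 1 (a * b)) ^ 3)⁻¹, by positivity, fun x s c hx h1 _ h2 _ => ?_⟩
  have hX : 0 < min 1 (a * b) * (1 + x) := mul_pos hm (by linarith)
  rw [abs_of_pos (inv_pos.2 (PP_pos ha hb hx h1 h2)),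
    show ((1 + x) ^ (-3 : ℤ)) = ((1 + x) ^ 3)⁻¹ from by rw [zpow_neg]; norm_cast,
    ← mul_inv, ← mul_pow]
  exact inv_anti₀ (by positivity) (PP_ge ha hb hx h1 h2)

/-! ### The pieces of the curvature -/

/-- `L log Σ`. -/
def LS (a b x s c : ℝ) : ℝ :=
  (4 * x + 2 * (c - s) * (b ^ 2 - a ^ 2)) / SS a b x s c -
    (4 * x ^ 2 + 4 * s * c * (b ^ 2 - a ^ 2) ^ 2) / SS a b x s c ^ 2

/-- `L log P`. -/
def LP (a b x s c : ℝ) : ℝ :=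
  (4 * x * PPx a b x s c + 4 * x ^ 2 * PPxx a b x s c + 2 * (c - s) * PPs a b x) / PP a b x s c -
    (4 * x ^ 2 * PPx a b x s c ^ 2 + 4 * s * c * PPs a b x ^ 2) / PP a b x s c ^ 2

def N1 (a b x s c : ℝ) : ℝ := a ^ 2 * (a + b) ^ 2 * s + AA a b x * SS a b x s c
def N2 (a b x s c : ℝ) : ℝ := b ^ 2 * (a + b) ^ 2 * c + BB a b x * SS a b x s c
def N1x (a b x s c : ℝ) : ℝ := AA a b x + SS a b x s c
def N2x (a b x s c : ℝ) : ℝ := BB a b x + SS a b x s c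
def N1s (a b x : ℝ) : ℝ := a ^ 2 * (a + b) ^ 2 + AA a b x * (b ^ 2 - a ^ 2)
def N2s (a b x : ℝ) : ℝ := - (b ^ 2 * (a + b) ^ 2) + BB a b x * (b ^ 2 - a ^ 2)
def KK (a b : ℝ) : ℝ := a * b * (a + b) ^ 2

def MM (a b x s c : ℝ) : ℝ :=
  2 * ((N1 a b x s c + x * N1x a b x s c) * (N2 a b x s c + x * N2x a b x s c) +
    (N1 a b x s c + s * N1s a b x) * (- N2 a b x s c + c * N2s a b x) -
    s * c * KK a b ^ 2 - (c - s) ^ 2 * KK a b ^ 2)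

def ell (a b x s c : ℝ) : ℝ := x * PPx a b x s c / PP a b x s c + x / SS a b x s c
def kk (a b x s c : ℝ) : ℝ := PPs a b x / PP a b x s c + (b ^ 2 - a ^ 2) / SS a b x s c

def TT (a b x s c : ℝ) : ℝ :=
  MM a b x s c / (PP a b x s c * SS a b x s c) -
    (ell a b x s c ^ 2 + s * c * kk a b x s c ^ 2) / 2 - 2 * ell a b x s c -
    (c - s) * kk a b x s c

def m1 (a b x s c : ℝ) : ℝ :=
  a ^ 2 * (a + b) ^ 2 * s + x * (a * b + a ^ 2 + s0 a b s c) + (a * b + a ^ 2) * s0 a b s c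
def m2 (a b x s c : ℝ) : ℝ :=
  b ^ 2 * (a + b) ^ 2 * c + x * (a * b + b ^ 2 + s0 a b s c) + (a * b + b ^ 2) * s0 a b s c
def u1 (a b x s c : ℝ) : ℝ := m1 a b x s c + x * (a * b + a ^ 2 + s0 a b s c)
def u2 (a b x s c : ℝ) : ℝ := m2 a b x s c + x * (a * b + b ^ 2 + s0 a b s c)
def v1 (a b x s c : ℝ) : ℝ := m1 a b x s c + s * N1s a b x
def v2 (a b x s c : ℝ) : ℝ := c * N2s a b x - m2 a b x s c
/-- `Q - x⁴`, where `Q = P Σ`. -/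
def q1 (a b x s c : ℝ) : ℝ :=
  x ^ 3 * s0 a b s c +
  (x ^ 2 * (a * b + a ^ 2 + (a * b + b ^ 2) + s0 a b s c) +
    x * ((a * b + a ^ 2) * (a * b + b ^ 2) + (a * b + a ^ 2 + (a * b + b ^ 2)) * s0 a b s c) +
    (a * b + a ^ 2) * (a * b + b ^ 2) * s0 a b s c +
    (a + b) ^ 2 * (a ^ 2 * (BB a b x * s) + b ^ 2 * (AA a b x * c))) * SS a b x s c

def M1 (a b x s c : ℝ) : ℝ :=
  2 * (3 * (x ^ 2 * (u1 a b x s c + u2 a b x s c)) + u1 a b x s c * u2 a b x s c +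
    x ^ 2 * (v2 a b x s c - v1 a b x s c) + v1 a b x s c * v2 a b x s c
    - s * c * KK a b ^ 2 - (c - s) ^ 2 * KK a b ^ 2) - 16 * q1 a b x s c

theorem MM_eq (a b x s c : ℝ) :
    MM a b x s c = 16 * (PP a b x s c * SS a b x s c) + M1 a b x s c := by
  simp only [MM, M1, PP, u1, u2, v1, v2, m1, m2, q1, N1, N2, N1x, N2x, SS, AA, BB]
  ring

theorem OB_X2 : OB 2 (fun x _ _ => x ^ 2) := by
  exact (OB.X.mul OB.X).congr fun x s c _ _ _ => by ring
theorem OB_X3 : OB 3 (fun x _ _ => x ^ 3) := by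
  exact ((OB.X.mul OB.X).mul OB.X).congr fun x s c _ _ _ => by ring

theorem OB_m1 (a b : ℝ) : OB 1 (fun x s c => m1 a b x s c) :=
  (((OB.S.cmul _).le (by norm_num)).add (OB.X.mul ((OB.const _).add (OB_s0 a b)))).add
    (((OB_s0 a b).cmul _).le (by norm_num))
theorem OB_m2 (a b : ℝ) : OB 1 (fun x s c => m2 a b x s c) :=
  (((OB.C.cmul _).le (by norm_num)).add (OB.X.mul ((OB.const _).add (OB_s0 a b)))).add
    (((OB_s0 a b).cmul _).le (by norm_num))
theorem OB_u1 (a b : ℝ) : OB 1 (fun x s c => u1 a b x s c) :=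
  (OB_m1 a b).add (OB.X.mul ((OB.const _).add (OB_s0 a b)))
theorem OB_u2 (a b : ℝ) : OB 1 (fun x s c => u2 a b x s c) :=
  (OB_m2 a b).add (OB.X.mul ((OB.const _).add (OB_s0 a b)))
theorem OB_N1s (a b : ℝ) : OB 1 (fun x _ _ => N1s a b x) :=
  ((OB.const _).le (by norm_num)).add ((OB_AA a b).mul (OB.const _))
theorem OB_N2s (a b : ℝ) : OB 1 (fun x _ _ => N2s a b x) :=
  ((OB.const _).le (by norm_num)).add ((OB_BB a b).mul (OB.const _))
theorem OB_v1 (a b : ℝ) : OB 1 (fun x s c => v1 a b x s c) :=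
  (OB_m1 a b).add (OB.S.mul (OB_N1s a b))
theorem OB_v2 (a b : ℝ) : OB 1 (fun x s c => v2 a b x s c) :=
  (OB.C.mul (OB_N2s a b)).sub (OB_m2 a b)

theorem OB_q1 (a b : ℝ) : OB 3 (fun x s c => q1 a b x s c) := by
  refine (OB_X3.mul (OB_s0 a b)).add (OB.mul (i := 2) (j := 1) ?_ (OB_SS a b))
  refine OB.add (OB.add (OB.add ?_ ?_) ?_) ?_
  · exact OB_X2.mul ((OB.const _).add (OB_s0 a b))
  · exact (OB.X.mul ((OB.const _).add ((OB_s0 a b).cmul _))).le (by norm_num)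
  · exact ((OB_s0 a b).cmul _).le (by norm_num)
  · exact ((OB_lin a b).cmul _).le (by norm_num)

theorem OB_cs : OB 0 (fun _ s c => c - s) := OB.C.sub OB.S

theorem OB_M1 (a b : ℝ) : OB 3 (fun x s c => M1 a b x s c) := by
  refine OB.sub (OB.cmul 2 (OB.sub (OB.sub (OB.add (OB.add (OB.add ?_ ?_) ?_) ?_) ?_) ?_))
    ((OB_q1 a b).cmul 16)
  · exact (OB_X2.mul ((OB_u1 a b).add (OB_u2 a b))).cmul 3
  · exact ((OB_u1 a b).mul (OB_u2 a b)).le (by norm_num)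
  · exact OB_X2.mul ((OB_v2 a b).sub (OB_v1 a b))
  · exact ((OB_v1 a b).mul (OB_v2 a b)).le (by norm_num)
  · exact ((OB.S.mul OB.C).mul (OB.const _)).le (by norm_num)
  · refine OB.le (i := 0) (OB.mul (i := 0) (j := 0) ?_ (OB.const _)) (by norm_num)
    exact (OB_cs.mul OB_cs).congr fun x s c _ _ _ => by ring

/-- `ell - 4`. -/
def ee (a b x s c : ℝ) : ℝ :=
  pd a b x s c * (PP a b x s c)⁻¹ - s0 a b s c * (SS a b x s c)⁻¹

theorem OB_ee {a b : ℝ} (ha : 0 < a) (hb : 0 < b) : OB (-1) (fun x s c => ee a b x s c) :=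
  ((OB_pd a b).mul (OB_PPinv ha hb)).sub ((OB_s0 a b).mul (OB_SSinv ha hb))

theorem OB_kk {a b : ℝ} (ha : 0 < a) (hb : 0 < b) : OB (-1) (fun x s c => kk a b x s c) := by
  simp only [kk, div_eq_mul_inv]
  exact ((OB_PPs a b).mul (OB_PPinv ha hb)).add ((OB_SSinv ha hb).cmul _)

theorem ell_eq {a b x s c : ℝ} (hP : PP a b x s c ≠ 0) (hS : SS a b x s c ≠ 0) :
    ell a b x s c = 4 + ee a b x s c := by
  unfold ell ee
  rw [pd_eq]
  have h : x = SS a b x s c - s0 a b s c := by unfold SS; ring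
  have h2 : x / SS a b x s c = 1 - s0 a b s c * (SS a b x s c)⁻¹ := by
    rw [div_eq_mul_inv]
    nth_rewrite 1 [h]
    field_simp
  rw [h2]
  field_simp
  ring

theorem OB_TT {a b : ℝ} (ha : 0 < a) (hb : 0 < b) : OB (-1) (fun x s c => TT a b x s c) := by
  have h : OB (-1) (fun x s c =>
      M1 a b x s c * ((PP a b x s c)⁻¹ * (SS a b x s c)⁻¹) - (6 : ℝ) * ee a b x s c
      - (1 / 2 : ℝ) * (ee a b x s c * ee a b x s c)
      - (1 / 2 : ℝ) * (s * c * (kk a b x s c * kk a b x s c)) - (c - s) * kk a b x s c) := by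
    refine OB.sub (OB.sub (OB.sub (OB.sub ?_ ?_) ?_) ?_) ?_
    · exact (OB_M1 a b).mul ((OB_PPinv ha hb).mul (OB_SSinv ha hb))
    · exact (OB_ee ha hb).cmul 6
    · exact (((OB_ee ha hb).mul (OB_ee ha hb)).cmul _).le (by norm_num)
    · exact (((OB.S.mul OB.C).mul ((OB_kk ha hb).mul (OB_kk ha hb))).cmul _).le (by norm_num)
    · exact OB_cs.mul (OB_kk ha hb)
  refine h.congr fun x s c hx hs hc => ?_
  have hP := (PP_pos ha hb hx hs hc).ne'
  have hS := (SS_pos ha hb hx hs hc).ne'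
  unfold TT
  rw [ell_eq hP hS, MM_eq]
  field_simp
  ring

theorem OB_LS {a b : ℝ} (ha : 0 < a) (hb : 0 < b) : OB (-1) (fun x s c => LS a b x s c) := by
  have h : OB (-1) (fun x s c =>
      (4 : ℝ) * (x * s0 a b s c * ((SS a b x s c)⁻¹ * (SS a b x s c)⁻¹))
      + (2 * (b ^ 2 - a ^ 2)) * ((c - s) * (SS a b x s c)⁻¹)
      - (4 * (b ^ 2 - a ^ 2) ^ 2) * (s * c * ((SS a b x s c)⁻¹ * (SS a b x s c)⁻¹))) := by
    have hS := OB_SSinv ha hb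
    refine OB.sub (OB.add ?_ ?_) ?_
    · exact ((OB.X.mul (OB_s0 a b)).mul (hS.mul hS)).cmul _
    · exact (OB_cs.mul hS).cmul _
    · exact (((OB.S.mul OB.C).mul (hS.mul hS)).cmul _).le (by norm_num)
  refine h.congr fun x s c hx hs hc => ?_
  have hS := (SS_pos ha hb hx hs hc).ne'
  have h : s0 a b s c = SS a b x s c - x := by unfold SS; ring
  unfold LS
  rw [h]
  field_simp
  ring

theorem OB_LP {a b : ℝ} (ha : 0 < a) (hb : 0 < b) : OB (-1) (fun x s c => LP a b x s c) := by
  have h : OB (-1) (fun x s c =>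
      (4 : ℝ) * ((x * pdx a b x s c - (3 : ℝ) * pd a b x s c) * (PP a b x s c)⁻¹)
      - (4 : ℝ) * ((pd a b x s c * pd a b x s c) * ((PP a b x s c)⁻¹ * (PP a b x s c)⁻¹))
      + (2 : ℝ) * ((c - s) * (PPs a b x * (PP a b x s c)⁻¹))
      - (4 : ℝ) * (s * c * (PPs a b x * PPs a b x * ((PP a b x s c)⁻¹ * (PP a b x s c)⁻¹)))) := by
    have hP := OB_PPinv ha hb
    refine OB.sub (OB.add (OB.sub ?_ ?_) ?_) ?_
    · exact (((OB.X.mul (OB_pdx a b)).sub ((OB_pd a b).cmul 3)).mul hP).cmul _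
    · exact ((((OB_pd a b).mul (OB_pd a b)).mul (hP.mul hP)).cmul _).le (by norm_num)
    · exact (OB_cs.mul ((OB_PPs a b).mul hP)).cmul _
    · exact (((OB.S.mul OB.C).mul (((OB_PPs a b).mul (OB_PPs a b)).mul (hP.mul hP))).cmul _).le
        (by norm_num)
  refine h.congr fun x s c hx hs hc => ?_
  have hP := (PP_pos ha hb hx hs hc).ne'
  have h1 := pd_eq a b x s c
  have h2 := pdx_eq a b x s c
  have e : LP a b x s c =
      (4 * (x * PPx a b x s c) + 4 * (x ^ 2 * PPxx a b x s c) + 2 * (c - s) * PPs a b x)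
        / PP a b x s c -
      (4 * (x * PPx a b x s c) ^ 2 + 4 * s * c * PPs a b x ^ 2) / PP a b x s c ^ 2 := by
    unfold LP; ring
  rw [e, h1, h2]
  field_simp
  ring

theorem OB_total {a b : ℝ} (ha : 0 < a) (hb : 0 < b) :
    OB 0 (fun x s c =>
      x * ((-3 / 2 : ℝ) * LS a b x s c + (1 / 2 : ℝ) * LP a b x s c + TT a b x s c)) :=
  OB.X.mul ((((OB_LS ha hb).cmul _).add ((OB_LP ha hb).cmul _)).add (OB_TT ha hb))

end MPaux

namespace MPaux
open MP Real

/-! ### Closed forms of the data -/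

section closed
variable {a b r θ : ℝ}

theorem Sig_eq (a b r θ : ℝ) : Sig a b r θ = SS a b (r ^ 2) (sin θ ^ 2) (cos θ ^ 2) := by
  simp only [Sig, SS, s0]; ring

theorem sig11_eq (h : SS a b (r ^ 2) (sin θ ^ 2) (cos θ ^ 2) ≠ 0) :
    sig11 a b r θ = sin θ ^ 2 * N1 a b (r ^ 2) (sin θ ^ 2) (cos θ ^ 2) /
      SS a b (r ^ 2) (sin θ ^ 2) (cos θ ^ 2) := by
  unfold sig11
  rw [Sig_eq]
  unfold N1
  rw [show Afun a b r = AA a b (r ^ 2) by simp only [Afun, AA]; ring]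
  field_simp

theorem sig22_eq (h : SS a b (r ^ 2) (sin θ ^ 2) (cos θ ^ 2) ≠ 0) :
    sig22 a b r θ = cos θ ^ 2 * N2 a b (r ^ 2) (sin θ ^ 2) (cos θ ^ 2) /
      SS a b (r ^ 2) (sin θ ^ 2) (cos θ ^ 2) := by
  unfold sig22
  rw [Sig_eq]
  unfold N2
  rw [show Bfun a b r = BB a b (r ^ 2) by simp only [Bfun, BB]; ring]
  field_simp

theorem sig12_eq (a b r θ : ℝ) :
    sig12 a b r θ = sin θ ^ 2 * (cos θ ^ 2 * KK a b) /
      SS a b (r ^ 2) (sin θ ^ 2) (cos θ ^ 2) := by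
  unfold sig12 KK
  rw [Sig_eq]
  ring

theorem N_det (a b x s c : ℝ) :
    N1 a b x s c * N2 a b x s c - s * c * KK a b ^ 2 = PP a b x s c * SS a b x s c := by
  simp only [N1, N2, KK, PP]; ring

theorem N_detx (a b x s c : ℝ) :
    N1x a b x s c * N2 a b x s c + N1 a b x s c * N2x a b x s c =
      PPx a b x s c * SS a b x s c + PP a b x s c := by
  simp only [N1, N2, N1x, N2x, PP, PPx]; ring

theorem N_dets (a b x s c : ℝ) :
    N1s a b x * N2 a b x s c + N1 a b x s c * N2s a b x - (c - s) * KK a b ^ 2 =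
      PPs a b x * SS a b x s c + PP a b x s c * (b ^ 2 - a ^ 2) := by
  simp only [N1, N2, N1s, N2s, PP, PPs, KK]; ring

theorem detSig_eq (h : SS a b (r ^ 2) (sin θ ^ 2) (cos θ ^ 2) ≠ 0) :
    detSig a b r θ = (sin θ * cos θ / SS a b (r ^ 2) (sin θ ^ 2) (cos θ ^ 2)) ^ 2 *
      (PP a b (r ^ 2) (sin θ ^ 2) (cos θ ^ 2) * SS a b (r ^ 2) (sin θ ^ 2) (cos θ ^ 2)) := by
  rw [← N_det]
  unfold detSig
  rw [sig11_eq h, sig22_eq h, sig12_eq]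
  field_simp

theorem sin_pos' (hθ : θ ∈ Set.Ioo 0 (π / 2)) : 0 < sin θ :=
  sin_pos_of_pos_of_lt_pi hθ.1 (by linarith [hθ.2, pi_pos])

theorem cos_pos' (hθ : θ ∈ Set.Ioo 0 (π / 2)) : 0 < cos θ :=
  cos_pos_of_mem_Ioo ⟨by linarith [hθ.1, pi_pos], hθ.2⟩

/-- `Q = P Σ` as a function of `r, θ`. -/
def QQ (a b x s c : ℝ) : ℝ := PP a b x s c * SS a b x s c

theorem Phi0_sq (ha : 0 < a) (hb : 0 < b) (hr : 0 < r) (hθ : θ ∈ Set.Ioo 0 (π / 2)) :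
    Phi0 a b r θ ^ 2 = √(QQ a b (r ^ 2) (sin θ ^ 2) (cos θ ^ 2)) /
      (r ^ 2 * SS a b (r ^ 2) (sin θ ^ 2) (cos θ ^ 2)) := by
  have hs := sin_pos' hθ
  have hc := cos_pos' hθ
  have hS := SS_pos (s := sin θ ^ 2) (c := cos θ ^ 2) ha hb (pow_pos hr 2)
    (sq_nonneg _) (sq_nonneg _)
  unfold Phi0
  rw [Real.sq_sqrt (by unfold rho; positivity), detSig_eq hS.ne', Real.sqrt_mul (sq_nonneg _),
    Real.sqrt_sq (by positivity)]
  unfold rho QQ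
  field_simp

theorem QQ_pos (ha : 0 < a) (hb : 0 < b) (hr : 0 < r) (θ : ℝ) :
    0 < QQ a b (r ^ 2) (sin θ ^ 2) (cos θ ^ 2) :=
  mul_pos (PP_pos ha hb (pow_pos hr 2) (sq_nonneg _) (sq_nonneg _))
    (SS_pos ha hb (pow_pos hr 2) (sq_nonneg _) (sq_nonneg _))

theorem sig11'_eq (ha : 0 < a) (hb : 0 < b) (hr : 0 < r) (hθ : θ ∈ Set.Ioo 0 (π / 2)) :
    sig11' a b r θ = r ^ 2 * (sin θ ^ 2 * N1 a b (r ^ 2) (sin θ ^ 2) (cos θ ^ 2)) /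
      √(QQ a b (r ^ 2) (sin θ ^ 2) (cos θ ^ 2)) := by
  have hS := SS_pos (s := sin θ ^ 2) (c := cos θ ^ 2) ha hb (pow_pos hr 2)
    (sq_nonneg _) (sq_nonneg _)
  have hQ := Real.sqrt_pos.2 (QQ_pos ha hb hr θ)
  unfold sig11'
  rw [Phi0_sq ha hb hr hθ, sig11_eq hS.ne']
  field_simp

theorem sig22'_eq (ha : 0 < a) (hb : 0 < b) (hr : 0 < r) (hθ : θ ∈ Set.Ioo 0 (π / 2)) :
    sig22' a b r θ = r ^ 2 * (cos θ ^ 2 * N2 a b (r ^ 2) (sin θ ^ 2) (cos θ ^ 2)) /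
      √(QQ a b (r ^ 2) (sin θ ^ 2) (cos θ ^ 2)) := by
  have hS := SS_pos (s := sin θ ^ 2) (c := cos θ ^ 2) ha hb (pow_pos hr 2)
    (sq_nonneg _) (sq_nonneg _)
  have hQ := Real.sqrt_pos.2 (QQ_pos ha hb hr θ)
  unfold sig22'
  rw [Phi0_sq ha hb hr hθ, sig22_eq hS.ne']
  field_simp

theorem sig12'_eq (ha : 0 < a) (hb : 0 < b) (hr : 0 < r) (hθ : θ ∈ Set.Ioo 0 (π / 2)) :
    sig12' a b r θ = r ^ 2 * (sin θ ^ 2 * (cos θ ^ 2 * KK a b)) /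
      √(QQ a b (r ^ 2) (sin θ ^ 2) (cos θ ^ 2)) := by
  have hS := SS_pos (s := sin θ ^ 2) (c := cos θ ^ 2) ha hb (pow_pos hr 2)
    (sq_nonneg _) (sq_nonneg _)
  have hQ := Real.sqrt_pos.2 (QQ_pos ha hb hr θ)
  unfold sig12'
  rw [Phi0_sq ha hb hr hθ, sig12_eq]
  field_simp

theorem Ufun_eq (ha : 0 < a) (hb : 0 < b) (hr : 0 < r) (hθ : θ ∈ Set.Ioo 0 (π / 2)) :
    Ufun a b r θ = 3 / 4 * log (SS a b (r ^ 2) (sin θ ^ 2) (cos θ ^ 2)) -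
      1 / 4 * log (PP a b (r ^ 2) (sin θ ^ 2) (cos θ ^ 2)) - log r := by
  have hS := SS_pos (s := sin θ ^ 2) (c := cos θ ^ 2) ha hb (pow_pos hr 2)
    (sq_nonneg _) (sq_nonneg _)
  have hP := PP_pos (s := sin θ ^ 2) (c := cos θ ^ 2) ha hb (pow_pos hr 2)
    (sq_nonneg _) (sq_nonneg _)
  have hQ := Real.sqrt_pos.2 (QQ_pos ha hb hr θ)
  unfold Ufun
  rw [Phi0_sq ha hb hr hθ, Sig_eq, Real.log_div hS.ne' (by positivity),
    Real.log_mul (by positivity) (by positivity), Real.log_div hQ.ne' (by positivity),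
    Real.log_mul (by positivity) hS.ne', Real.log_sqrt (QQ_pos ha hb hr θ).le]
  unfold QQ
  rw [Real.log_mul hP.ne' hS.ne', Real.log_pow, Real.log_pow]
  push_cast
  ring

end closed

/-! ### Derivatives -/

theorem dA (a b x : ℝ) : HasDerivAt (fun x => AA a b x) 1 x := (hasDerivAt_id x).add_const _
theorem dB (a b x : ℝ) : HasDerivAt (fun x => BB a b x) 1 x := (hasDerivAt_id x).add_const _
theorem dS (a b x s c : ℝ) : HasDerivAt (fun x => SS a b x s c) 1 x :=
  (hasDerivAt_id x).add_const _

theorem dP (a b x s c : ℝ) : HasDerivAt (fun x => PP a b x s c) (PPx a b x s c) x := by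
  have h := (((dA a b x).mul (dB a b x)).mul (dS a b x s c)).add
    (((((dB a b x).mul_const s).const_mul (a ^ 2)).add
      (((dA a b x).mul_const c).const_mul (b ^ 2))).const_mul ((a + b) ^ 2))
  refine h.congr_deriv ?_
  simp only [PPx, Pi.mul_apply]
  ring

theorem dPx (a b x s c : ℝ) : HasDerivAt (fun x => PPx a b x s c) (PPxx a b x s c) x := by
  have h := ((((dA a b x).add (dB a b x)).mul (dS a b x s c)).add
    ((dA a b x).mul (dB a b x))).add_const ((a + b) ^ 2 * (a ^ 2 * s + b ^ 2 * c))
  refine h.congr_deriv ?_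
  simp only [PPxx, Pi.add_apply]
  ring

theorem dN1 (a b x s c : ℝ) : HasDerivAt (fun x => N1 a b x s c) (N1x a b x s c) x := by
  have h := ((dA a b x).mul (dS a b x s c)).const_add (a ^ 2 * (a + b) ^ 2 * s)
  refine h.congr_deriv ?_
  simp only [N1x]
  ring

theorem dN2 (a b x s c : ℝ) : HasDerivAt (fun x => N2 a b x s c) (N2x a b x s c) x := by
  have h := ((dB a b x).mul (dS a b x s c)).const_add (b ^ 2 * (a + b) ^ 2 * c)
  refine h.congr_deriv ?_
  simp only [N2x]
  ring

/-- Chain rule with `x = r²`. -/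
theorem dsq {f : ℝ → ℝ} {f' r : ℝ} (h : HasDerivAt f f' (r ^ 2)) :
    HasDerivAt (fun y => f (y ^ 2)) (2 * r * f') r := by
  have h2 : HasDerivAt (fun y : ℝ => y ^ 2) (2 * r) r := by simpa using hasDerivAt_pow 2 r
  exact (HasDerivAt.comp (h₂ := f) (h := fun y : ℝ => y ^ 2) r h h2).congr_deriv (by ring)

theorem dsin2 (t : ℝ) : HasDerivAt (fun t => sin t ^ 2) (2 * sin t * cos t) t := by
  refine ((hasDerivAt_sin t).pow 2).congr_deriv ?_
  push_cast; ring

theorem dcos2 (t : ℝ) : HasDerivAt (fun t => cos t ^ 2) (-(2 * sin t * cos t)) t := by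
  refine ((hasDerivAt_cos t).pow 2).congr_deriv ?_
  push_cast; ring

theorem daff (e0 e1 e2 t : ℝ) : HasDerivAt (fun t => e0 + e1 * sin t ^ 2 + e2 * cos t ^ 2)
    (2 * sin t * cos t * (e1 - e2)) t := by
  refine ((((dsin2 t).const_mul e1).const_add e0).add ((dcos2 t).const_mul e2)).congr_deriv ?_
  ring

theorem tS (a b x t : ℝ) : HasDerivAt (fun t => SS a b x (sin t ^ 2) (cos t ^ 2))
    (2 * sin t * cos t * (b ^ 2 - a ^ 2)) t := by
  convert daff (x + a * b) (b ^ 2) (a ^ 2) t using 2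
  simp only [SS, s0]; ring

theorem tP (a b x t : ℝ) : HasDerivAt (fun t => PP a b x (sin t ^ 2) (cos t ^ 2))
    (2 * sin t * cos t * PPs a b x) t := by
  have h := daff (AA a b x * BB a b x * (x + a * b))
    (AA a b x * BB a b x * b ^ 2 + (a + b) ^ 2 * a ^ 2 * BB a b x)
    (AA a b x * BB a b x * a ^ 2 + (a + b) ^ 2 * b ^ 2 * AA a b x) t
  convert h using 1
  · funext t; simp only [PP, SS, s0]; ring
  · simp only [PPs]; ring

theorem tN1 (a b x t : ℝ) : HasDerivAt (fun t => N1 a b x (sin t ^ 2) (cos t ^ 2))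
    (2 * sin t * cos t * N1s a b x) t := by
  have h := daff (AA a b x * (x + a * b)) (AA a b x * b ^ 2 + a ^ 2 * (a + b) ^ 2)
    (AA a b x * a ^ 2) t
  convert h using 1
  · funext t; simp only [N1, SS, s0]; ring
  · simp only [N1s]; ring

theorem tN2 (a b x t : ℝ) : HasDerivAt (fun t => N2 a b x (sin t ^ 2) (cos t ^ 2))
    (2 * sin t * cos t * N2s a b x) t := by
  have h := daff (BB a b x * (x + a * b)) (BB a b x * b ^ 2)
    (BB a b x * a ^ 2 + b ^ 2 * (a + b) ^ 2) t
  convert h using 1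
  · funext t; simp only [N2, SS, s0]; ring
  · simp only [N2s]; ring

theorem dsc (t : ℝ) : HasDerivAt (fun t => 2 * sin t * cos t) (2 * (cos t ^ 2 - sin t ^ 2)) t := by
  refine (((hasDerivAt_sin t).const_mul 2).mul (hasDerivAt_cos t)).congr_deriv ?_
  ring

/-- Derivative of `n / √q`. -/
theorem dquot {F n q : ℝ → ℝ} {n' q' t : ℝ} {I : Set ℝ} (hI : IsOpen I) (ht : t ∈ I)
    (hF : ∀ y ∈ I, F y = n y / √(q y)) (hn : HasDerivAt n n' t) (hq : HasDerivAt q q' t)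
    (h0 : 0 < q t) : deriv F t = (n' * q t - n t * q' / 2) / (q t * √(q t)) := by
  have h := hn.div (hq.sqrt h0.ne') (Real.sqrt_pos.2 h0).ne'
  have e : F =ᶠ[nhds t] fun y => n y / √(q y) :=
    Filter.eventually_of_mem (hI.mem_nhds ht) hF
  rw [e.deriv_eq]
  refine (HasDerivAt.deriv h).trans ?_
  have hs := Real.sqrt_pos.2 h0
  have h2 := Real.sq_sqrt h0.le
  generalize √(q t) = R at hs h2
  rw [← h2]
  field_simp

/-- Second derivative of a combination of logarithms. -/
theorem dlog2 {U f f1 g g1 h h1 : ℝ → ℝ} {f2 g2 h2 t : ℝ} {I : Set ℝ} (hI : IsOpen I)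
    (hU : ∀ y ∈ I, U y = 3 / 4 * log (f y) - 1 / 4 * log (g y) - log (h y))
    (hf : ∀ y ∈ I, HasDerivAt f (f1 y) y) (hg : ∀ y ∈ I, HasDerivAt g (g1 y) y)
    (hh : ∀ y ∈ I, HasDerivAt h (h1 y) y)
    (f0 : ∀ y ∈ I, 0 < f y) (g0 : ∀ y ∈ I, 0 < g y) (h0 : ∀ y ∈ I, 0 < h y)
    (ht : t ∈ I)
    (hf2 : HasDerivAt f1 f2 t) (hg2 : HasDerivAt g1 g2 t) (hh2 : HasDerivAt h1 h2 t) :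
    deriv U t = 3 / 4 * (f1 t / f t) - 1 / 4 * (g1 t / g t) - h1 t / h t ∧
    deriv (fun y => deriv U y) t = 3 / 4 * (f2 / f t - (f1 t / f t) ^ 2)
      - 1 / 4 * (g2 / g t - (g1 t / g t) ^ 2) - (h2 / h t - (h1 t / h t) ^ 2) := by
  have key : ∀ y ∈ I, deriv U y =
      3 / 4 * (f1 y / f y) - 1 / 4 * (g1 y / g y) - h1 y / h y := by
    intro y hy
    have e : U =ᶠ[nhds y] fun y => 3 / 4 * log (f y) - 1 / 4 * log (g y) - log (h y) :=
      Filter.eventually_of_mem (hI.mem_nhds hy) hU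
    rw [e.deriv_eq]
    exact ((((hf y hy).log (f0 y hy).ne').const_mul (3 / 4)).sub
      (((hg y hy).log (g0 y hy).ne').const_mul (1 / 4))).sub
      ((hh y hy).log (h0 y hy).ne') |>.deriv
  refine ⟨key t ht, ?_⟩
  have e : (fun y => deriv U y) =ᶠ[nhds t] fun y =>
      3 / 4 * (f1 y / f y) - 1 / 4 * (g1 y / g y) - h1 y / h y :=
    Filter.eventually_of_mem (hI.mem_nhds ht) key
  have f0' := (f0 t ht).ne'
  have g0' := (g0 t ht).ne'
  have h0' := (h0 t ht).ne'
  rw [e.deriv_eq]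
  have hd := (((hf2.div (hf t ht) f0').const_mul (3 / 4)).sub
      ((hg2.div (hg t ht) g0').const_mul (1 / 4))).sub (hh2.div (hh t ht) h0')
  refine (HasDerivAt.deriv hd).trans ?_
  field_simp

/-- The Laplacian of `U`. -/
theorem lap_eq {a b r θ : ℝ} (ha : 0 < a) (hb : 0 < b) (hr : 0 < r)
    (hθ : θ ∈ Set.Ioo 0 (π / 2)) :
    Delta2 (Ufun a b) r θ = (3 / 4 * LS a b (r ^ 2) (sin θ ^ 2) (cos θ ^ 2)
      - 1 / 4 * LP a b (r ^ 2) (sin θ ^ 2) (cos θ ^ 2)) / r ^ 4 := by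
  have hSp : ∀ y t : ℝ, 0 < y → 0 < SS a b (y ^ 2) (sin t ^ 2) (cos t ^ 2) := fun y t hy =>
    SS_pos ha hb (pow_pos hy 2) (sq_nonneg _) (sq_nonneg _)
  have hPp : ∀ y t : ℝ, 0 < y → 0 < PP a b (y ^ 2) (sin t ^ 2) (cos t ^ 2) := fun y t hy =>
    PP_pos ha hb (pow_pos hy 2) (sq_nonneg _) (sq_nonneg _)
  have d2 : HasDerivAt (fun y : ℝ => 2 * y) 2 r := by
    simpa using (hasDerivAt_id r).const_mul 2
  obtain ⟨r1, r2⟩ := dlog2 (U := fun y => Ufun a b y θ)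
    (f := fun y => SS a b (y ^ 2) (sin θ ^ 2) (cos θ ^ 2)) (f1 := fun y => 2 * y * 1)
    (g := fun y => PP a b (y ^ 2) (sin θ ^ 2) (cos θ ^ 2))
    (g1 := fun y => 2 * y * PPx a b (y ^ 2) (sin θ ^ 2) (cos θ ^ 2))
    (h := fun y => y) (h1 := fun _ => 1) (I := Set.Ioi 0) (t := r) isOpen_Ioi
    (fun y hy => Ufun_eq ha hb hy hθ) (fun y _ => dsq (dS a b _ _ _))
    (fun y _ => dsq (dP a b _ _ _)) (fun y _ => hasDerivAt_id y)
    (fun y hy => hSp y θ hy) (fun y hy => hPp y θ hy) (fun y hy => hy) hr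
    (d2.mul_const 1) (d2.mul (dsq (dPx a b _ _ _))) (hasDerivAt_const _ _)
  obtain ⟨t1, t2⟩ := dlog2 (U := fun t => Ufun a b r t)
    (f := fun t => SS a b (r ^ 2) (sin t ^ 2) (cos t ^ 2))
    (f1 := fun t => 2 * sin t * cos t * (b ^ 2 - a ^ 2))
    (g := fun t => PP a b (r ^ 2) (sin t ^ 2) (cos t ^ 2))
    (g1 := fun t => 2 * sin t * cos t * PPs a b (r ^ 2))
    (h := fun _ => r) (h1 := fun _ => 0) (I := Set.Ioo 0 (π / 2)) (t := θ) isOpen_Ioo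
    (fun t ht => Ufun_eq ha hb hr ht) (fun t _ => tS a b _ t)
    (fun t _ => tP a b _ t) (fun t _ => hasDerivAt_const _ _)
    (fun t _ => hSp r t hr) (fun t _ => hPp r t hr) (fun _ _ => hr) hθ
    ((dsc θ).mul_const _) ((dsc θ).mul_const _) (hasDerivAt_const _ _)
  have e1 : pdr (Ufun a b) r θ = _ := r1
  have e2 : pdr (pdr (Ufun a b)) r θ = _ := r2
  have e3 : pdt (pdt (Ufun a b)) r θ = _ := t2
  have hS := (hSp r θ hr).ne'
  have hP := (hPp r θ hr).ne'
  unfold Delta2 LS LP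
  rw [e1, e2, e3]
  clear r1 r2 t1 t2 e1 e2 e3 hSp hPp d2
  generalize SS a b (r ^ 2) (sin θ ^ 2) (cos θ ^ 2) = S at *
  generalize PP a b (r ^ 2) (sin θ ^ 2) (cos θ ^ 2) = P at *
  field_simp
  ring

/-- Algebra behind the quadratic gradient term. -/
theorem grad_alg {r S C R Q M1 M1x M1s M2 M2x M2s K Qx Qs : ℝ} (hr : r ≠ 0) (hS : S ≠ 0)
    (hC : C ≠ 0) (hR : R ≠ 0) (hQ : R ^ 2 = Q) (h0 : M1 * M2 - S ^ 2 * C ^ 2 * K ^ 2 = Q)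
    (hx : M1x * M2 + M1 * M2x = Qx)
    (hs : M1s * M2 + M1 * M2s - (C ^ 2 - S ^ 2) * K ^ 2 = Qs) :
    (((2 * r * (S ^ 2 * (M1 + r ^ 2 * M1x)) * Q
          - r ^ 2 * (S ^ 2 * M1) * (2 * r * Qx) / 2) / (Q * R) *
        ((2 * r * (C ^ 2 * (M2 + r ^ 2 * M2x)) * Q
          - r ^ 2 * (C ^ 2 * M2) * (2 * r * Qx) / 2) / (Q * R)) +
      (2 * S * C * (r ^ 2 * (M1 + S ^ 2 * M1s)) * Q
          - r ^ 2 * (S ^ 2 * M1) * (2 * S * C * Qs) / 2) / (Q * R) *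
        ((2 * S * C * (r ^ 2 * (-M2 + C ^ 2 * M2s)) * Q
          - r ^ 2 * (C ^ 2 * M2) * (2 * S * C * Qs) / 2) / (Q * R)) / r ^ 2) / r ^ 2 -
    ((2 * r * (S ^ 2 * (C ^ 2 * K)) * Q
          - r ^ 2 * (S ^ 2 * (C ^ 2 * K)) * (2 * r * Qx) / 2) / (Q * R) *
        ((2 * r * (S ^ 2 * (C ^ 2 * K)) * Q
          - r ^ 2 * (S ^ 2 * (C ^ 2 * K)) * (2 * r * Qx) / 2) / (Q * R)) +
      (2 * S * C * (r ^ 2 * ((C ^ 2 - S ^ 2) * K)) * Q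
          - r ^ 2 * (S ^ 2 * (C ^ 2 * K)) * (2 * S * C * Qs) / 2) / (Q * R) *
        ((2 * S * C * (r ^ 2 * ((C ^ 2 - S ^ 2) * K)) * Q
          - r ^ 2 * (S ^ 2 * (C ^ 2 * K)) * (2 * S * C * Qs) / 2) / (Q * R)) / r ^ 2) / r ^ 2) /
      (2 * (r ^ 2 * S * C) ^ 2) =
    (2 * ((M1 + r ^ 2 * M1x) * (M2 + r ^ 2 * M2x) +
      (M1 + S ^ 2 * M1s) * (-M2 + C ^ 2 * M2s) - S ^ 2 * C ^ 2 * K ^ 2 -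
      (C ^ 2 - S ^ 2) ^ 2 * K ^ 2) / Q - ((r ^ 2 * Qx / Q) ^ 2 + S ^ 2 * C ^ 2 * (Qs / Q) ^ 2) / 2
      - 2 * (r ^ 2 * Qx / Q) - (C ^ 2 - S ^ 2) * (Qs / Q)) / r ^ 4 := by
  have hQ0 : Q ≠ 0 := by rw [← hQ]; positivity
  obtain ⟨l, hl⟩ : ∃ l, Qx = l * Q := ⟨Qx / Q, by field_simp⟩
  obtain ⟨k, hk⟩ : ∃ k, Qs = k * Q := ⟨Qs / Q, by field_simp⟩
  rw [hl] at hx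
  rw [hk] at hs
  rw [hl, hk]
  have e1 : r ^ 2 * (l * Q) / Q = r ^ 2 * l := by field_simp
  have e2 : k * Q / Q = k := by field_simp
  rw [e1, e2]
  have step : (M1 + r ^ 2 * M1x - r ^ 2 * M1 * l / 2) * (M2 + r ^ 2 * M2x - r ^ 2 * M2 * l / 2) +
      (M1 + S ^ 2 * M1s - S ^ 2 * M1 * k / 2) * (-M2 + C ^ 2 * M2s - C ^ 2 * M2 * k / 2) -
      S ^ 2 * C ^ 2 * (K - r ^ 2 * K * l / 2) ^ 2 -
      ((C ^ 2 - S ^ 2) * K - S ^ 2 * C ^ 2 * K * k / 2) ^ 2 =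
      ((M1 + r ^ 2 * M1x) * (M2 + r ^ 2 * M2x) +
      (M1 + S ^ 2 * M1s) * (-M2 + C ^ 2 * M2s) - S ^ 2 * C ^ 2 * K ^ 2 -
      (C ^ 2 - S ^ 2) ^ 2 * K ^ 2) - r ^ 2 * l * Q - (r ^ 2 * l) ^ 2 * Q / 4
      - k * (C ^ 2 - S ^ 2) * Q / 2 - S ^ 2 * C ^ 2 * k ^ 2 * Q / 4 := by
    linear_combination (-(r ^ 2 * l) + (r ^ 2 * l) ^ 2 / 4 - k * (C ^ 2 - S ^ 2) / 2
      + S ^ 2 * C ^ 2 * k ^ 2 / 4) * h0 - r ^ 4 * l / 2 * hx - k * S ^ 2 * C ^ 2 / 2 * hs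
  have q1 : ∀ X Y Z W : ℝ, (X * Q - Y * (Z * (l * Q)) / 2) / (Q * R) = (X - Y * (Z * l) / 2) / R := by
    intro X Y Z W; field_simp
  have q2 : ∀ X Y Z W : ℝ, (X * Q - Y * (Z * (k * Q)) / 2) / (Q * R) = (X - Y * (Z * k) / 2) / R := by
    intro X Y Z W; field_simp
  simp only [q1 _ _ _ 0, q2 _ _ _ 0]
  trans 2 * ((M1 + r ^ 2 * M1x - r ^ 2 * M1 * l / 2) * (M2 + r ^ 2 * M2x - r ^ 2 * M2 * l / 2) +
      (M1 + S ^ 2 * M1s - S ^ 2 * M1 * k / 2) * (-M2 + C ^ 2 * M2s - C ^ 2 * M2 * k / 2) -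
      S ^ 2 * C ^ 2 * (K - r ^ 2 * K * l / 2) ^ 2 -
      ((C ^ 2 - S ^ 2) * K - S ^ 2 * C ^ 2 * K * k / 2) ^ 2) / Q / r ^ 4
  · clear step e1 e2 q1 q2 h0 hx hs hl hk
    subst hQ
    field_simp
    ring
  · rw [step]
    field_simp
    ring

theorem dQr (a b r s c : ℝ) : HasDerivAt (fun y => QQ a b (y ^ 2) s c)
    (2 * r * (PPx a b (r ^ 2) s c * SS a b (r ^ 2) s c + PP a b (r ^ 2) s c)) r := by
  refine dsq (f := fun x => QQ a b x s c) ?_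
  exact ((dP a b _ s c).mul (dS a b _ s c)).congr_deriv (by ring)

theorem dQt (a b x t : ℝ) : HasDerivAt (fun t => QQ a b x (sin t ^ 2) (cos t ^ 2))
    (2 * sin t * cos t * (PPs a b x * SS a b x (sin t ^ 2) (cos t ^ 2) +
      PP a b x (sin t ^ 2) (cos t ^ 2) * (b ^ 2 - a ^ 2))) t :=
  ((tP a b x t).mul (tS a b x t)).congr_deriv (by ring)

theorem grad_eq {a b r θ : ℝ} (ha : 0 < a) (hb : 0 < b) (hr : 0 < r)
    (hθ : θ ∈ Set.Ioo 0 (π / 2)) :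
    (dInner (sig11' a b) (sig22' a b) r θ - dInner (sig12' a b) (sig12' a b) r θ) /
      (2 * rho r θ ^ 2) = TT a b (r ^ 2) (sin θ ^ 2) (cos θ ^ 2) / r ^ 4 := by
  have hP := PP_pos (s := sin θ ^ 2) (c := cos θ ^ 2) ha hb (pow_pos hr 2)
    (sq_nonneg _) (sq_nonneg _)
  have hS := SS_pos (s := sin θ ^ 2) (c := cos θ ^ 2) ha hb (pow_pos hr 2)
    (sq_nonneg _) (sq_nonneg _)
  have hQ := QQ_pos ha hb hr θ
  have dr2 : HasDerivAt (fun y : ℝ => y ^ 2) (2 * r) r := by simpa using hasDerivAt_pow 2 r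
  have e1 : pdr (sig11' a b) r θ = _ :=
    dquot (n := fun y => y ^ 2 * (sin θ ^ 2 * N1 a b (y ^ 2) (sin θ ^ 2) (cos θ ^ 2)))
      (n' := 2 * r * (sin θ ^ 2 * (N1 a b (r ^ 2) (sin θ ^ 2) (cos θ ^ 2) +
        r ^ 2 * N1x a b (r ^ 2) (sin θ ^ 2) (cos θ ^ 2)))) isOpen_Ioi (Set.mem_Ioi.2 hr)
      (fun y hy => sig11'_eq ha hb hy hθ)
      ((dr2.mul ((dsq (dN1 a b _ _ _)).const_mul (sin θ ^ 2))).congr_deriv (by ring))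
      (dQr a b r _ _) hQ
  have e2 : pdr (sig22' a b) r θ = _ :=
    dquot (n := fun y => y ^ 2 * (cos θ ^ 2 * N2 a b (y ^ 2) (sin θ ^ 2) (cos θ ^ 2)))
      (n' := 2 * r * (cos θ ^ 2 * (N2 a b (r ^ 2) (sin θ ^ 2) (cos θ ^ 2) +
        r ^ 2 * N2x a b (r ^ 2) (sin θ ^ 2) (cos θ ^ 2)))) isOpen_Ioi (Set.mem_Ioi.2 hr)
      (fun y hy => sig22'_eq ha hb hy hθ)
      ((dr2.mul ((dsq (dN2 a b _ _ _)).const_mul (cos θ ^ 2))).congr_deriv (by ring))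
      (dQr a b r _ _) hQ
  have e3 : pdr (sig12' a b) r θ = _ :=
    dquot (n := fun y => y ^ 2 * (sin θ ^ 2 * (cos θ ^ 2 * KK a b)))
      (n' := 2 * r * (sin θ ^ 2 * (cos θ ^ 2 * KK a b))) isOpen_Ioi (Set.mem_Ioi.2 hr)
      (fun y hy => sig12'_eq ha hb hy hθ)
      (dr2.mul_const _) (dQr a b r _ _) hQ
  have f1 : pdt (sig11' a b) r θ = _ :=
    dquot (n := fun t => r ^ 2 * (sin t ^ 2 * N1 a b (r ^ 2) (sin t ^ 2) (cos t ^ 2)))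
      (n' := 2 * sin θ * cos θ * (r ^ 2 * (N1 a b (r ^ 2) (sin θ ^ 2) (cos θ ^ 2) +
        sin θ ^ 2 * N1s a b (r ^ 2)))) isOpen_Ioo hθ
      (fun t ht => sig11'_eq ha hb hr ht)
      ((((dsin2 θ).mul (tN1 a b _ θ)).const_mul (r ^ 2)).congr_deriv (by ring))
      (dQt a b (r ^ 2) θ) hQ
  have f2 : pdt (sig22' a b) r θ = _ :=
    dquot (n := fun t => r ^ 2 * (cos t ^ 2 * N2 a b (r ^ 2) (sin t ^ 2) (cos t ^ 2)))
      (n' := 2 * sin θ * cos θ * (r ^ 2 * (-N2 a b (r ^ 2) (sin θ ^ 2) (cos θ ^ 2) +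
        cos θ ^ 2 * N2s a b (r ^ 2)))) isOpen_Ioo hθ
      (fun t ht => sig22'_eq ha hb hr ht)
      ((((dcos2 θ).mul (tN2 a b _ θ)).const_mul (r ^ 2)).congr_deriv (by ring))
      (dQt a b (r ^ 2) θ) hQ
  have f3 : pdt (sig12' a b) r θ = _ :=
    dquot (n := fun t => r ^ 2 * (sin t ^ 2 * (cos t ^ 2 * KK a b)))
      (n' := 2 * sin θ * cos θ * (r ^ 2 * ((cos θ ^ 2 - sin θ ^ 2) * KK a b))) isOpen_Ioo hθ
      (fun t ht => sig12'_eq ha hb hr ht)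
      ((((dsin2 θ).mul ((dcos2 θ).mul_const (KK a b))).const_mul (r ^ 2)).congr_deriv (by ring))
      (dQt a b (r ^ 2) θ) hQ
  unfold dInner rho
  rw [e1, e2, e3, f1, f2, f3]
  have G := grad_alg (Q := QQ a b (r ^ 2) (sin θ ^ 2) (cos θ ^ 2)) hr.ne' (sin_pos' hθ).ne'
    (cos_pos' hθ).ne' (Real.sqrt_pos.2 hQ).ne' (Real.sq_sqrt hQ.le)
    (N_det a b (r ^ 2) (sin θ ^ 2) (cos θ ^ 2)) (N_detx a b (r ^ 2) (sin θ ^ 2) (cos θ ^ 2))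
    (N_dets a b (r ^ 2) (sin θ ^ 2) (cos θ ^ 2))
  refine G.trans ?_
  unfold TT MM ell kk QQ
  congr 1
  have g1 : r ^ 2 * (PPx a b (r ^ 2) (sin θ ^ 2) (cos θ ^ 2) *
      SS a b (r ^ 2) (sin θ ^ 2) (cos θ ^ 2) + PP a b (r ^ 2) (sin θ ^ 2) (cos θ ^ 2)) /
      (PP a b (r ^ 2) (sin θ ^ 2) (cos θ ^ 2) * SS a b (r ^ 2) (sin θ ^ 2) (cos θ ^ 2)) =
      r ^ 2 * PPx a b (r ^ 2) (sin θ ^ 2) (cos θ ^ 2) / PP a b (r ^ 2) (sin θ ^ 2) (cos θ ^ 2) +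
      r ^ 2 / SS a b (r ^ 2) (sin θ ^ 2) (cos θ ^ 2) := by
    field_simp
  have g2 : (PPs a b (r ^ 2) * SS a b (r ^ 2) (sin θ ^ 2) (cos θ ^ 2) +
      PP a b (r ^ 2) (sin θ ^ 2) (cos θ ^ 2) * (b ^ 2 - a ^ 2)) /
      (PP a b (r ^ 2) (sin θ ^ 2) (cos θ ^ 2) * SS a b (r ^ 2) (sin θ ^ 2) (cos θ ^ 2)) =
      PPs a b (r ^ 2) / PP a b (r ^ 2) (sin θ ^ 2) (cos θ ^ 2) +
      (b ^ 2 - a ^ 2) / SS a b (r ^ 2) (sin θ ^ 2) (cos θ ^ 2) := by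
    field_simp
  rw [g1, g2]

end MPaux

open MP in
/-- Bound on the rescaled scalar curvature of the extreme Myers–Perry conformal data
(`a ≠ b`): `|R̃₀| ≤ C r⁻⁴` for a constant `C > 0` depending only on `a` and `b`. -/
theorem Rt0_bound (a b : ℝ) (ha : 0 < a) (hb : 0 < b) (hab : a ≠ b) :
    ∃ C : ℝ, 0 < C ∧
      ∀ r θ : ℝ, 0 < r → θ ∈ Set.Ioo 0 (Real.pi / 2) →
        |Rt0 a b r θ| ≤ C / r ^ 4 := by
  obtain ⟨C, hC, h⟩ := MPaux.OB_total ha hb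
  refine ⟨C + 1, by linarith, fun r θ hr hθ => ?_⟩
  have h1 := h (r ^ 2) (Real.sin θ ^ 2) (Real.cos θ ^ 2) (pow_pos hr 2) (sq_nonneg _)
    (Real.sin_sq_le_one θ) (sq_nonneg _) (Real.cos_sq_le_one θ)
  rw [zpow_zero, mul_one] at h1
  have e : Rt0 a b r θ = (r ^ 2 * (-3 / 2 * MPaux.LS a b (r ^ 2) (Real.sin θ ^ 2) (Real.cos θ ^ 2)
      + 1 / 2 * MPaux.LP a b (r ^ 2) (Real.sin θ ^ 2) (Real.cos θ ^ 2)
      + MPaux.TT a b (r ^ 2) (Real.sin θ ^ 2) (Real.cos θ ^ 2))) / r ^ 4 := by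
    unfold Rt0
    rw [MPaux.lap_eq ha hb hr hθ, MPaux.grad_eq ha hb hr hθ]
    ring
  rw [e, abs_div, abs_of_pos (pow_pos hr 4)]
  gcongr
  linarith

end
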